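/- arXiv:2004.14655 — 2 statements merged into one kernel-verified Lean document; each statement's English description precedes it below -/
import Mathlib

section
/- Let X be a real normed space whose norm is URED, let t > 0, let i ≥ 1 be an integer, and let k be a positive integer with k ≥ i·t². Then every discrete martingale (M_n) with values in X belonging to Ξ̃_k(U_i(t)) satisfies sup_n E‖M_n‖² ≥ t²/4; that is, a_k(U_i(t)) ≥ t/2. -/
open MeasureTheory Filter Topology

/-- `N` is a norm on the real vector space `X`. -/
def IsNormOn {X : Type*} [AddCommGroup X] [Module ℝ X] (N : X → ℝ) : Prop :=
  (∀ x y : X, N (x + y) ≤ N x + N y) ∧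
  (∀ (a : ℝ) (x : X), N (a • x) = |a| * N x) ∧
  (∀ x : X, N x = 0 → x = 0)

/-- `N` is uniformly rotund in every direction (URED). -/
def IsUREDNorm {X : Type*} [AddCommGroup X] [Module ℝ X] (N : X → ℝ) : Prop :=
  ∀ (x y : ℕ → X) (z : X) (r : ℕ → ℝ),
    (∀ n, N (x n) = 1) → (∀ n, N (y n) = 1) →
    Tendsto (fun n => N ((2⁻¹ : ℝ) • (x n + y n))) atTop (𝓝 1) →
    (∀ n, x n - y n = r n • z) →
    Tendsto (fun n => N (x n - y n)) atTop (𝓝 0)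

/-- A martingale setup: a sequence of finite measurable partitions of `Ω`, each refining
the previous one. -/
structure MartingaleSetup (Ω : Type*) [MeasurableSpace Ω] (p : Measure Ω) where
  part : ℕ → Finset (Set Ω)
  meas : ∀ n, ∀ E ∈ part n, MeasurableSet E
  disj : ∀ n, (↑(part n) : Set (Set Ω)).PairwiseDisjoint id
  cover : ∀ n, ⋃₀ (↑(part n) : Set (Set Ω)) = Set.univ
  refines : ∀ n, ∀ E ∈ part (n + 1), ∃ F ∈ part n, E ⊆ F

namespace MartingaleSetup

variable {Ω : Type*} [MeasurableSpace Ω] {p : Measure Ω}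

/-- Membership in the algebra `𝒜_n` generated by the `n`-th partition. -/
def MemAlg (S : MartingaleSetup Ω p) (n : ℕ) (E : Set Ω) : Prop :=
  ∃ T : Finset (Set Ω), T ⊆ S.part n ∧ E = ⋃₀ (↑T : Set (Set Ω))

/-- `Ω_k`: the union of all `k`-Walsh-Paley pairs, i.e. pairs `E₁, E₂ ∈ ℰ_k` with
`p E₁ = p E₂` and `E₁ ∪ E₂ ∈ ℰ_{k-1}`. -/
def wpUnion (S : MartingaleSetup Ω p) (k : ℕ) : Set Ω :=
  ⋃₀ {E | ∃ E₁ E₂ : Set Ω, E₁ ∈ S.part k ∧ E₂ ∈ S.part k ∧ p E₁ = p E₂ ∧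
      E₁ ∪ E₂ ∈ S.part (k - 1) ∧ (E = E₁ ∨ E = E₂)}

end MartingaleSetup

/-- A discrete martingale adapted to a martingale setup: each `M n` is constant on every
element of the `n`-th partition, and the increment `dM n = M n - M (n-1)` has zero integral
on every element of the algebra generated by the `(n-1)`-st partition (stated through
continuous linear functionals, so that it makes sense in any normed space). -/
def IsSimpleMartingale {Ω X : Type*} [MeasurableSpace Ω] {p : Measure Ω}
    [NormedAddCommGroup X] [NormedSpace ℝ X]
    (S : MartingaleSetup Ω p) (M : ℕ → Ω → X) : Prop :=
  (∀ n, ∀ E ∈ S.part n, ∀ ω ∈ E, ∀ ω' ∈ E, M n ω = M n ω') ∧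
  (∀ n, 1 ≤ n → ∀ E : Set Ω, S.MemAlg (n - 1) E → ∀ φ : X →L[ℝ] ℝ,
    ∫ ω in E, φ (M n ω - M (n - 1) ω) ∂p = 0)

/-- Membership in `Ξ̃_k(H)`: there are at least `k` distinct indices `n ≥ 1` and measurable
sets `D n` with `dM n (D n) ⊆ H` and `∫_{D n ∩ Ω_n} ‖dM n‖² dp ≥ 1`. -/
def MemXi {Ω X : Type*} [MeasurableSpace Ω] {p : Measure Ω}
    [NormedAddCommGroup X] [NormedSpace ℝ X]
    (S : MartingaleSetup Ω p) (M : ℕ → Ω → X) (H : Set X) (k : ℕ) : Prop :=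
  ∃ (N : Finset ℕ) (D : ℕ → Set Ω), k ≤ N.card ∧
    ∀ n ∈ N, 1 ≤ n ∧ MeasurableSet (D n) ∧
      (∀ ω ∈ D n, M n ω - M (n - 1) ω ∈ H) ∧
      1 ≤ ∫ ω in D n ∩ S.wpUnion n, ‖M n ω - M (n - 1) ω‖ ^ 2 ∂p

/-- The set `U_i(t)` of vectors `x` such that
`‖x + y‖² + ‖x - y‖² ≥ (1 + 1/i)·2‖y‖²` whenever `‖y‖ ≤ t‖x‖`. -/
def UredBall (X : Type*) [NormedAddCommGroup X] (t : ℝ) (i : ℕ) : Set X :=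
  {x | ∀ y : X, ‖y‖ ≤ t * ‖x‖ →
    (1 + (i : ℝ)⁻¹) * (2 * ‖y‖ ^ 2) ≤ ‖x + y‖ ^ 2 + ‖x - y‖ ^ 2}

/-- The midpoint gain of the squared norm in a direction of `UredBall X t i`. -/
theorem sq_norm_gain_of_mem_uredBall {X : Type*} [NormedAddCommGroup X] [NormedSpace ℝ X]
    {t : ℝ} {i : ℕ} (hi : 1 ≤ i) {x y : X} (hx : x ∈ UredBall X t i) (hy : ‖y‖ ≤ t * ‖x‖) :
    (2 * i : ℝ)⁻¹ * ‖x‖ ^ 2 + ‖y‖ ^ 2 ≤ (‖y + x‖ ^ 2 + ‖y - x‖ ^ 2) / 2 := by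
  have h1 := hx y hy
  rw [add_comm x y, norm_sub_rev x y] at h1
  have hi' : (1 : ℝ) ≤ i := by exact_mod_cast hi
  have h2 : 2 * ‖x‖ ≤ ‖y + x‖ + ‖y - x‖ := by
    have h := norm_sub_le (y + x) (y - x)
    rwa [show y + x - (y - x) = (2 : ℝ) • x by rw [two_smul]; abel, norm_smul,
      Real.norm_ofNat] at h
  have h3 : 2 * ‖x‖ ^ 2 ≤ ‖y + x‖ ^ 2 + ‖y - x‖ ^ 2 := by
    nlinarith [norm_nonneg x, sq_nonneg (‖y + x‖ - ‖y - x‖)]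
  rw [mul_inv]
  have hj0 : (0 : ℝ) < (i : ℝ)⁻¹ := by positivity
  have hj1 : (i : ℝ)⁻¹ ≤ 1 := inv_le_one_of_one_le₀ hi'
  generalize (i : ℝ)⁻¹ = j at *
  generalize ‖y + x‖ ^ 2 + ‖y - x‖ ^ 2 = s at *
  by_cases hc : ‖x‖ ^ 2 ≤ 2 * ‖y‖ ^ 2
  · nlinarith
  · nlinarith [sq_nonneg ‖x‖]

namespace MartingaleSetup

variable {Ω : Type*} [MeasurableSpace Ω] {p : Measure Ω} (S : MartingaleSetup Ω p)

/-- `f` is constant on every element of the `n`-th partition. -/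
def PartConst {α : Type*} (n : ℕ) (f : Ω → α) : Prop :=
  ∀ E ∈ S.part n, ∀ ω ∈ E, ∀ ω' ∈ E, f ω = f ω'

variable {S}

theorem exists_mem_part (S : MartingaleSetup Ω p) (n : ℕ) (ω : Ω) : ∃ E ∈ S.part n, ω ∈ E := by
  have h : ω ∈ ⋃₀ (↑(S.part n) : Set (Set Ω)) := by rw [S.cover]; trivial
  obtain ⟨E, hE, hω⟩ := h
  exact ⟨E, hE, hω⟩

theorem eq_of_mem_part {n : ℕ} {E F : Set Ω} (hE : E ∈ S.part n) (hF : F ∈ S.part n) {ω : Ω}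
    (hωE : ω ∈ E) (hωF : ω ∈ F) : E = F := by
  by_contra h
  exact Set.disjoint_left.1 (S.disj n hE hF h) hωE hωF

theorem PartConst.succ {α : Type*} {n : ℕ} {f : Ω → α} (hf : S.PartConst n f) :
    S.PartConst (n + 1) f := by
  intro E hE ω hω ω' hω'
  obtain ⟨F, hF, hEF⟩ := S.refines n E hE
  exact hf F hF ω (hEF hω) ω' (hEF hω')

theorem PartConst.measurableSet_preimage {α : Type*} {n : ℕ} {f : Ω → α}
    (hf : S.PartConst n f) (s : Set α) : MeasurableSet (f ⁻¹' s) := by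
  have h : f ⁻¹' s = ⋃₀ {E ∈ (S.part n : Set (Set Ω)) | ∃ ω ∈ E, f ω ∈ s} := by
    ext ω
    constructor
    · intro hω
      obtain ⟨E, hE, hωE⟩ := S.exists_mem_part n ω
      exact ⟨E, ⟨hE, ω, hωE, hω⟩, hωE⟩
    · rintro ⟨E, ⟨hE, ω', hω', hs⟩, hωE⟩
      rw [Set.mem_preimage, hf E hE ω hωE ω' hω']
      exact hs
  rw [h]
  exact MeasurableSet.sUnion ((S.part n).finite_toSet.subset fun _ h => h.1).countable
    fun E hE => S.meas n E hE.1

theorem PartConst.finite_range {α : Type*} {n : ℕ} {f : Ω → α} (hf : S.PartConst n f) :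
    (Set.range f).Finite := by
  refine ((S.part n).finite_toSet.biUnion (t := fun E => f '' E) fun E hE => ?_).subset ?_
  · refine Set.Subsingleton.finite ?_
    rintro _ ⟨ω, hω, rfl⟩ _ ⟨ω', hω', rfl⟩
    exact hf E hE ω hω ω' hω'
  · rintro _ ⟨ω, rfl⟩
    obtain ⟨E, hE, hωE⟩ := S.exists_mem_part n ω
    exact Set.mem_biUnion (Finset.mem_coe.2 hE) ⟨ω, hωE, rfl⟩

theorem PartConst.integrable [IsFiniteMeasure p] {n : ℕ} {f : Ω → ℝ} (hf : S.PartConst n f) :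
    Integrable f p :=
  SimpleFunc.integrable_of_isFiniteMeasure
    ⟨f, fun x => hf.measurableSet_preimage {x}, hf.finite_range⟩

theorem integral_eq_sum_part {n : ℕ} {f : Ω → ℝ} (hf : Integrable f p) :
    ∫ ω, f ω ∂p = ∑ E ∈ S.part n, ∫ ω in E, f ω ∂p := by
  rw [← integral_biUnion_finset (S.part n) (S.meas n) (S.disj n) fun _ _ => hf.integrableOn,
    ← setIntegral_univ, ← S.cover n, Set.sUnion_eq_biUnion]
  rfl

theorem partConst_mem_wpUnion (S : MartingaleSetup Ω p) (n : ℕ) :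
    S.PartConst n (fun ω => ω ∈ S.wpUnion n) := by
  have key : ∀ E ∈ S.part n, ∀ ω ∈ E, ∀ ω' ∈ E, ω ∈ S.wpUnion n → ω' ∈ S.wpUnion n := by
    rintro E hE ω hω ω' hω' ⟨A, hA, hωA⟩
    have hAn : A ∈ S.part n := by
      obtain ⟨E₁, E₂, h₁, h₂, -, -, rfl | rfl⟩ := hA <;> assumption
    exact ⟨A, hA, eq_of_mem_part hE hAn hω hωA ▸ hω'⟩
  intro E hE ω hω ω' hω'
  exact propext ⟨key E hE ω hω ω' hω', key E hE ω' hω' ω hω⟩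

theorem memAlg_of_mem_part {n : ℕ} {E : Set Ω} (hE : E ∈ S.part n) : S.MemAlg n E :=
  ⟨{E}, by simpa using hE, by simp⟩

end MartingaleSetup

section Increments

open MartingaleSetup

variable {Ω X : Type*} [MeasurableSpace Ω] {p : Measure Ω} [NormedAddCommGroup X]
  [NormedSpace ℝ X] {S : MartingaleSetup Ω p} {M : ℕ → Ω → X}

/-- The part of `Ω_{n+1}` on which the increment lies in `UredBall X t i` and dominates the
current value of the martingale. -/
def gainSet (S : MartingaleSetup Ω p) (M : ℕ → Ω → X) (t : ℝ) (i n : ℕ) : Set Ω :=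
  {ω | ω ∈ S.wpUnion (n + 1) ∧ M (n + 1) ω - M n ω ∈ UredBall X t i ∧
    ‖M n ω‖ ≤ t * ‖M (n + 1) ω - M n ω‖}

theorem IsSimpleMartingale.partConst_gain (hM : IsSimpleMartingale S M) (t : ℝ) (i n : ℕ) :
    S.PartConst (n + 1)
      ((gainSet S M t i n).indicator fun ω => ‖M (n + 1) ω - M n ω‖ ^ 2) := by
  classical
  intro E hE ω hω ω' hω'
  have h : S.PartConst n (M n) := hM.1 n
  have hw : (ω ∈ S.wpUnion (n + 1)) = (ω' ∈ S.wpUnion (n + 1)) :=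
    S.partConst_mem_wpUnion (n + 1) E hE ω hω ω' hω'
  simp only [Set.indicator_apply, gainSet, Set.mem_ofPred_eq, hw,
    hM.1 (n + 1) E hE ω hω ω' hω', h.succ E hE ω hω ω' hω']

variable [IsProbabilityMeasure p]

/-- Jensen's inequality on an atom of the partition. -/
theorem IsSimpleMartingale.setIntegral_sq_norm_le (hM : IsSimpleMartingale S M) {n : ℕ}
    {F : Set Ω} (hF : F ∈ S.part n) :
    ∫ ω in F, ‖M n ω‖ ^ 2 ∂p ≤ ∫ ω in F, ‖M (n + 1) ω‖ ^ 2 ∂p := by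
  rcases F.eq_empty_or_nonempty with rfl | ⟨ω₀, hω₀⟩
  · simp
  obtain ⟨φ, hφ, hφy⟩ := exists_dual_vector'' ℝ (M n ω₀)
  have hφy' : φ (M n ω₀) = ‖M n ω₀‖ := by simpa using hφy
  have hc : S.PartConst n (M n) := hM.1 n
  have hc' : S.PartConst (n + 1) (M (n + 1)) := hM.1 (n + 1)
  have hdc : S.PartConst (n + 1) (fun ω => φ (M (n + 1) ω - M n ω)) := fun E hE ω hω ω' hω' => by
    simp only [hc' E hE ω hω ω' hω', hc.succ E hE ω hω ω' hω']
  have hsc : S.PartConst n (fun ω => ‖M n ω‖ ^ 2) := fun E hE ω hω ω' hω' => by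
    simp only [hc E hE ω hω ω' hω']
  have hsc' : S.PartConst (n + 1) (fun ω => ‖M (n + 1) ω‖ ^ 2) := fun E hE ω hω ω' hω' => by
    simp only [hc' E hE ω hω ω' hω']
  have hzero := hM.2 (n + 1) (by lia) F (memAlg_of_mem_part hF) φ
  simp only [Nat.add_sub_cancel] at hzero
  calc ∫ ω in F, ‖M n ω‖ ^ 2 ∂p
      = ∫ ω in F, (‖M n ω‖ ^ 2 + 2 * ‖M n ω₀‖ * φ (M (n + 1) ω - M n ω)) ∂p := by
        rw [integral_add hsc.integrable.integrableOn (hdc.integrable.integrableOn.const_mul _),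
          integral_const_mul, hzero, mul_zero, add_zero]
    _ ≤ _ := by
        refine setIntegral_mono_on
          (hsc.integrable.integrableOn.add (hdc.integrable.integrableOn.const_mul _))
          hsc'.integrable.integrableOn (S.meas n F hF) fun ω hω => ?_
        rw [hc F hF ω hω ω₀ hω₀, map_sub, hφy']
        have h : |φ (M (n + 1) ω)| ≤ ‖M (n + 1) ω‖ := by
          have := φ.le_of_opNorm_le hφ (M (n + 1) ω)
          simpa using this
        have h2 : φ (M (n + 1) ω) ^ 2 ≤ ‖M (n + 1) ω‖ ^ 2 := sq_le_sq' (abs_le.1 h).1 (abs_le.1 h).2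
        nlinarith [sq_nonneg (φ (M (n + 1) ω) - ‖M n ω₀‖)]

/-- The increments on the two halves of a Walsh-Paley pair are opposite. -/
theorem IsSimpleMartingale.increment_add_eq_zero (hM : IsSimpleMartingale S M) {n : ℕ}
    {E₁ E₂ : Set Ω} (h₁ : E₁ ∈ S.part (n + 1)) (h₂ : E₂ ∈ S.part (n + 1)) (hp : p E₁ = p E₂)
    (hF : E₁ ∪ E₂ ∈ S.part n) (hp0 : p E₁ ≠ 0) {ω₁ ω₂ : Ω} (hω₁ : ω₁ ∈ E₁) (hω₂ : ω₂ ∈ E₂) :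
    (M (n + 1) ω₁ - M n ω₁) + (M (n + 1) ω₂ - M n ω₂) = 0 := by
  have hc : S.PartConst (n + 1) (fun ω => M (n + 1) ω - M n ω) := fun E hE ω hω ω' hω' => by
    have h : S.PartConst n (M n) := hM.1 n
    simp only [hM.1 (n + 1) E hE ω hω ω' hω', h.succ E hE ω hω ω' hω']
  refine SeparatingDual.eq_zero_of_forall_dual_eq_zero (R := ℝ) fun φ => ?_
  have hpr : p.real E₁ ≠ 0 := by
    rw [measureReal_def]
    exact ENNReal.toReal_ne_zero.2 ⟨hp0, measure_ne_top _ _⟩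
  have hpr' : p.real E₂ = p.real E₁ := by simp only [measureReal_def, hp]
  have hφc : S.PartConst (n + 1) (fun ω => φ (M (n + 1) ω - M n ω)) :=
    fun E hE ω hω ω' hω' => congrArg φ (hc E hE ω hω ω' hω')
  have hval : ∀ E ∈ S.part (n + 1), ∀ ω₀ ∈ E,
      ∫ ω in E, φ (M (n + 1) ω - M n ω) ∂p = p.real E * φ (M (n + 1) ω₀ - M n ω₀) := by
    intro E hE ω₀ hω₀
    rw [setIntegral_congr_fun (S.meas _ E hE) fun ω hω => hφc E hE ω hω ω₀ hω₀,
      setIntegral_const, smul_eq_mul]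
  have hzero := hM.2 (n + 1) (by lia) (E₁ ∪ E₂) (memAlg_of_mem_part hF) φ
  simp only [Nat.add_sub_cancel] at hzero
  by_cases hE : E₁ = E₂
  · subst hE
    rw [Set.union_self, hval E₁ h₁ ω₁ hω₁] at hzero
    have h0 := (mul_eq_zero.1 hzero).resolve_left hpr
    have h0' : φ (M (n + 1) ω₂ - M n ω₂) = 0 := (hφc E₁ h₁ ω₂ hω₂ ω₁ hω₁).trans h0
    rw [map_add, h0, h0', add_zero]
  · have hd : Disjoint E₁ E₂ := S.disj _ h₁ h₂ hE
    rw [setIntegral_union hd (S.meas _ E₂ h₂) hφc.integrable.integrableOn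
      hφc.integrable.integrableOn, hval E₁ h₁ ω₁ hω₁, hval E₂ h₂ ω₂ hω₂, hpr', ← mul_add] at hzero
    rw [map_add]
    exact (mul_eq_zero.1 hzero).resolve_left hpr

/-- On an atom of the partition, the squared norm of the martingale gains at least a multiple of
the squared increment over `gainSet`. -/
theorem IsSimpleMartingale.setIntegral_gain_le (hM : IsSimpleMartingale S M) {t : ℝ} {i : ℕ}
    (hi : 1 ≤ i) {n : ℕ} {F : Set Ω} (hF : F ∈ S.part n) :
    ∫ ω in F, ((2 * i : ℝ)⁻¹ *
        (gainSet S M t i n).indicator (fun ω => ‖M (n + 1) ω - M n ω‖ ^ 2) ω + ‖M n ω‖ ^ 2) ∂p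
      ≤ ∫ ω in F, ‖M (n + 1) ω‖ ^ 2 ∂p := by
  classical
  have hc : S.PartConst n (M n) := hM.1 n
  have hc' : S.PartConst (n + 1) (M (n + 1)) := hM.1 (n + 1)
  have hsc : S.PartConst n (fun ω => ‖M n ω‖ ^ 2) := fun E hE ω hω ω' hω' => by
    simp only [hc E hE ω hω ω' hω']
  have hsc' : S.PartConst (n + 1) (fun ω => ‖M (n + 1) ω‖ ^ 2) := fun E hE ω hω ω' hω' => by
    simp only [hc' E hE ω hω ω' hω']
  have hgi := (hM.partConst_gain t i n).integrable
  rcases (F ∩ gainSet S M t i n).eq_empty_or_nonempty with hempty | ⟨ω₀, hω₀F, hω₀⟩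
  · refine le_of_eq_of_le (setIntegral_congr_fun (S.meas n F hF) fun ω hω => ?_)
      (hM.setIntegral_sq_norm_le hF)
    have : ω ∉ gainSet S M t i n := fun h => (hempty ▸ ⟨hω, h⟩ : ω ∈ (∅ : Set Ω))
    simp [this]
  obtain ⟨⟨E, ⟨E₁, E₂, h₁, h₂, hp, hU, hE⟩, hω₀E⟩, hball, hle⟩ := hω₀
  wlog hE1 : E = E₁ generalizing E₁ E₂
  · exact this E₂ E₁ h₂ h₁ hp.symm (Set.union_comm E₁ E₂ ▸ hU) hE.symm
      (hE.resolve_left hE1)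
  subst hE1
  simp only [Nat.add_sub_cancel] at hU
  obtain rfl : F = E ∪ E₂ := eq_of_mem_part hF hU hω₀F (Or.inl hω₀E)
  by_cases hp0 : p E = 0
  · have hFp : p (E ∪ E₂) = 0 := measure_union_null hp0 (hp ▸ hp0)
    rw [Measure.restrict_eq_zero.2 hFp, integral_zero_measure, integral_zero_measure]
  obtain ⟨ω₂, hω₂⟩ : E₂.Nonempty := nonempty_of_measure_ne_zero (hp ▸ hp0)
  have hy₂ : M n ω₂ = M n ω₀ := hc _ hF ω₂ (Or.inr hω₂) ω₀ (Or.inl hω₀E)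
  have hsum := hM.increment_add_eq_zero h₁ h₂ hp hU hp0 hω₀E hω₂
  rw [hy₂] at hsum
  set y := M n ω₀ with hy
  set x := M (n + 1) ω₀ - y with hx
  have hM0 : M (n + 1) ω₀ = y + x := by rw [hx]; abel
  have hM2 : M (n + 1) ω₂ = y - x := by
    rw [sub_eq_add_neg, ← eq_neg_of_add_eq_zero_right hsum]; abel
  have hpr : p.real E₂ = p.real E := by simp only [measureReal_def, hp]
  have hgain := sq_norm_gain_of_mem_uredBall hi hball hle
  have hnorm : ∀ ω ∈ E ∪ E₂, ‖M (n + 1) ω - M n ω‖ = ‖x‖ := by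
    intro ω hω
    rw [hc _ hF ω hω ω₀ hω₀F, ← hy]
    rcases hω with hω | hω
    · rw [hc' E h₁ ω hω ω₀ hω₀E]
    · rw [hc' E₂ h₂ ω hω ω₂ hω₂, eq_neg_of_add_eq_zero_right hsum, norm_neg]
  have hupper : ∫ ω in E ∪ E₂, ((2 * i : ℝ)⁻¹ * (gainSet S M t i n).indicator
      (fun ω => ‖M (n + 1) ω - M n ω‖ ^ 2) ω + ‖M n ω‖ ^ 2) ∂p
      ≤ p.real (E ∪ E₂) * ((2 * i : ℝ)⁻¹ * ‖x‖ ^ 2 + ‖y‖ ^ 2) := by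
    rw [← smul_eq_mul (p.real (E ∪ E₂)), ← setIntegral_const]
    refine setIntegral_mono_on ((hgi.const_mul _).add hsc.integrable).integrableOn
      integrableOn_const (S.meas n _ hF) fun ω hω => ?_
    rw [hc _ hF ω hω ω₀ hω₀F, ← hy]
    gcongr
    rw [Set.indicator_apply, hc _ hF ω hω ω₀ hω₀F, ← hy]
    split_ifs
    · have := hnorm ω hω
      rw [hc _ hF ω hω ω₀ hω₀F, ← hy] at this
      rw [this]
    · positivity
  refine hupper.trans ?_
  by_cases hEE : E = E₂
  · subst hEE
    have hx0 : x = 0 := by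
      have h : y + x = y - x := by rw [← hM0, ← hM2, hc' E h₁ ω₀ hω₀E ω₂ hω₂]
      have h2 : (2 : ℝ) • x = 0 := by
        rw [two_smul]
        calc x + x = (y + x) - (y - x) := by abel
          _ = 0 := by rw [h, sub_self]
      exact (smul_eq_zero.1 h2).resolve_left two_ne_zero
    refine le_of_eq_of_le ?_ (hM.setIntegral_sq_norm_le hF)
    rw [setIntegral_congr_fun (S.meas n _ hF) fun ω hω => hsc _ hF ω hω ω₀ hω₀F,
      setIntegral_const, smul_eq_mul, hx0]
    simp [hy]
  · have hd : Disjoint E E₂ := S.disj _ h₁ h₂ hEE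
    rw [setIntegral_union hd (S.meas _ E₂ h₂) hsc'.integrable.integrableOn
        hsc'.integrable.integrableOn,
      setIntegral_congr_fun (S.meas _ E h₁) fun ω hω => hsc' _ h₁ ω hω ω₀ hω₀E,
      setIntegral_congr_fun (S.meas _ E₂ h₂) fun ω hω => hsc' _ h₂ ω hω ω₂ hω₂,
      setIntegral_const, setIntegral_const, smul_eq_mul, smul_eq_mul,
      measureReal_union hd (S.meas _ E₂ h₂), hpr]
    beta_reduce
    rw [hM0, hM2]
    nlinarith [measureReal_nonneg (μ := p) (s := E)]

theorem IsSimpleMartingale.integrable_sq_norm (hM : IsSimpleMartingale S M) (n : ℕ) :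
    Integrable (fun ω => ‖M n ω‖ ^ 2) p :=
  PartConst.integrable (S := S) (n := n) fun E hE ω hω ω' hω' => by
    simp only [hM.1 n E hE ω hω ω' hω']

theorem IsSimpleMartingale.integral_gain_le (hM : IsSimpleMartingale S M) (t : ℝ) {i : ℕ}
    (hi : 1 ≤ i) (n : ℕ) :
    (2 * i : ℝ)⁻¹ *
        ∫ ω, (gainSet S M t i n).indicator (fun ω => ‖M (n + 1) ω - M n ω‖ ^ 2) ω ∂p
      + ∫ ω, ‖M n ω‖ ^ 2 ∂p ≤ ∫ ω, ‖M (n + 1) ω‖ ^ 2 ∂p := by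
  have hgi := (hM.partConst_gain t i n).integrable.const_mul (2 * i : ℝ)⁻¹
  have hsum := integral_eq_sum_part (S := S) (n := n) (hgi.add (hM.integrable_sq_norm n))
  simp only [Pi.add_apply] at hsum
  rw [← integral_const_mul, ← integral_add hgi (hM.integrable_sq_norm n), hsum,
    integral_eq_sum_part (S := S) (n := n) (hM.integrable_sq_norm (n + 1))]
  exact Finset.sum_le_sum fun F hF => hM.setIntegral_gain_le hi hF

/-- The squared increment in directions of `UredBall X t i` over Walsh-Paley pairs is controlled
by its part over `gainSet` and the current second moment. -/
theorem IsSimpleMartingale.sq_mul_setIntegral_le (hM : IsSimpleMartingale S M) {t : ℝ}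
    (ht : 0 < t) {i n : ℕ} {D : Set Ω} (hD : MeasurableSet D)
    (hDU : ∀ ω ∈ D, M (n + 1) ω - M n ω ∈ UredBall X t i) :
    t ^ 2 * ∫ ω in D ∩ S.wpUnion (n + 1), ‖M (n + 1) ω - M n ω‖ ^ 2 ∂p ≤
      t ^ 2 * ∫ ω, (gainSet S M t i n).indicator (fun ω => ‖M (n + 1) ω - M n ω‖ ^ 2) ω ∂p
      + ∫ ω, ‖M n ω‖ ^ 2 ∂p := by
  have hc : S.PartConst n (M n) := hM.1 n
  have hdc : S.PartConst (n + 1) (fun ω => ‖M (n + 1) ω - M n ω‖ ^ 2) :=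
    fun E hE ω hω ω' hω' => by
      simp only [hM.1 (n + 1) E hE ω hω ω' hω', hc.succ E hE ω hω ω' hω']
  have hW : MeasurableSet (S.wpUnion (n + 1)) :=
    (S.partConst_mem_wpUnion (n + 1)).measurableSet_preimage {q | q}
  have hgi := (hM.partConst_gain t i n).integrable.const_mul (t ^ 2)
  rw [← integral_indicator (hD.inter hW), ← integral_const_mul, ← integral_const_mul,
    ← integral_add hgi (hM.integrable_sq_norm n)]
  refine integral_mono ((hdc.integrable.indicator (hD.inter hW)).const_mul _)
    (hgi.add (hM.integrable_sq_norm n)) fun ω => ?_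
  by_cases hω : ω ∈ D ∩ S.wpUnion (n + 1)
  · by_cases hle : ‖M n ω‖ ≤ t * ‖M (n + 1) ω - M n ω‖
    · have hG : ω ∈ gainSet S M t i n := ⟨hω.2, hDU ω hω.1, hle⟩
      simp only [Set.indicator_of_mem hω, Set.indicator_of_mem hG]
      linarith [sq_nonneg ‖M n ω‖]
    · have hG : ω ∉ gainSet S M t i n := fun h => hle h.2.2
      simp only [Set.indicator_of_mem hω, Set.indicator_of_notMem hG, mul_zero, zero_add]
      rw [← mul_pow]
      exact pow_le_pow_left₀ (by positivity) (not_le.1 hle).le 2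
  · simp only [Set.indicator_of_notMem hω, mul_zero]
    have : 0 ≤ (gainSet S M t i n).indicator (fun ω => ‖M (n + 1) ω - M n ω‖ ^ 2) ω :=
      Set.indicator_nonneg (fun _ _ => by positivity) ω
    positivity

end Increments

/-- If the norm of `X` is URED and `k ≥ i·t²`, then every martingale in `Ξ̃_k(U_i(t))`
satisfies `sup_n E‖M_n‖² ≥ t²/4`, i.e. `a_k(U_i(t)) ≥ t/2`. -/
theorem stmt10 {X : Type*} [NormedAddCommGroup X] [NormedSpace ℝ X]
    (hURED : IsUREDNorm (fun x : X => ‖x‖))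
    (t : ℝ) (ht : 0 < t) (i : ℕ) (hi : 1 ≤ i)
    (k : ℕ) (hk1 : 1 ≤ k) (hk : (i : ℝ) * t ^ 2 ≤ k)
    {Ω : Type*} [MeasurableSpace Ω] {p : Measure Ω} [IsProbabilityMeasure p]
    (S : MartingaleSetup Ω p) (M : ℕ → Ω → X) (hM : IsSimpleMartingale S M)
    (hXi : MemXi S M (UredBall X t i) k) :
    ∀ c : ℝ, c < t ^ 2 / 4 → ∃ n, c < ∫ ω, ‖M n ω‖ ^ 2 ∂p := by
  obtain ⟨N, D, hcard, hN⟩ := hXi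
  intro c hcc
  by_contra! hsmall
  have hlt : ∀ n, ∫ ω, ‖M n ω‖ ^ 2 ∂p < t ^ 2 / 4 := fun n => (hsmall n).trans_lt hcc
  have hi0 : (0 : ℝ) < i := by exact_mod_cast hi
  have hgain0 : ∀ n,
      0 ≤ ∫ ω, (gainSet S M t i n).indicator (fun ω => ‖M (n + 1) ω - M n ω‖ ^ 2) ω ∂p :=
    fun n => integral_nonneg fun ω => Set.indicator_nonneg (fun _ _ => by positivity) ω
  have hstep : ∀ n, n + 1 ∈ N → ∫ ω, ‖M n ω‖ ^ 2 ∂p + (4 * i : ℝ)⁻¹ ≤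
      ∫ ω, ‖M (n + 1) ω‖ ^ 2 ∂p := by
    intro n hn
    obtain ⟨-, hDm, hDU, hint⟩ := hN (n + 1) hn
    simp only [Nat.add_sub_cancel] at hDU hint
    have h1 := hM.sq_mul_setIntegral_le ht hDm hDU
    have h2 := hM.integral_gain_le t hi n
    have h3 := hlt n
    have ht2 : 0 < t ^ 2 := by positivity
    have h4 : (1 / 2 : ℝ) ≤
        ∫ ω, (gainSet S M t i n).indicator (fun ω => ‖M (n + 1) ω - M n ω‖ ^ 2) ω ∂p := by
      by_contra! h
      nlinarith
    have h5 : (4 * i : ℝ)⁻¹ = (2 * i : ℝ)⁻¹ * (1 / 2) := by field_simp; norm_num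
    have h6 := mul_le_mul_of_nonneg_left h4 (by positivity : (0 : ℝ) ≤ (2 * i : ℝ)⁻¹)
    linarith
  have hcount : ∀ m, ((N.filter (· ≤ m)).card : ℝ) * (4 * i : ℝ)⁻¹ ≤ ∫ ω, ‖M m ω‖ ^ 2 ∂p := by
    intro m
    induction m with
    | zero =>
      have : N.filter (· ≤ 0) = ∅ := Finset.filter_eq_empty_iff.2 fun n hn h0 => by
        have := (hN n hn).1
        lia
      rw [this, Finset.card_empty, Nat.cast_zero, zero_mul]
      exact integral_nonneg fun ω => by positivity
    | succ m ih =>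
      by_cases hm : m + 1 ∈ N
      · have hsub : N.filter (· ≤ m + 1) ⊆ insert (m + 1) (N.filter (· ≤ m)) := by
          intro n
          simp only [Finset.mem_filter, Finset.mem_insert]
          grind
        have h : ((N.filter (· ≤ m + 1)).card : ℝ) ≤ (N.filter (· ≤ m)).card + 1 := by
          exact_mod_cast (Finset.card_le_card hsub).trans (Finset.card_insert_le _ _)
        have h' := mul_le_mul_of_nonneg_right h (by positivity : (0 : ℝ) ≤ (4 * i : ℝ)⁻¹)
        linarith [hstep m hm]
      · have heq : N.filter (· ≤ m + 1) = N.filter (· ≤ m) :=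
          Finset.filter_congr fun n hn => by grind
        have h := hM.integral_gain_le t hi m
        have h' := mul_nonneg (by positivity : (0 : ℝ) ≤ (2 * i : ℝ)⁻¹) (hgain0 m)
        rw [heq]
        linarith
  have hall : N.filter (· ≤ N.sup id) = N :=
    Finset.filter_true_of_mem fun n hn => Finset.le_sup (f := id) hn
  have hfinal := hcount (N.sup id)
  rw [hall] at hfinal
  have hkN : (i : ℝ) * t ^ 2 ≤ N.card := hk.trans (by exact_mod_cast hcard)
  have h := mul_le_mul_of_nonneg_right hkN (by positivity : (0 : ℝ) ≤ (4 * i : ℝ)⁻¹)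
  have heq : (i : ℝ) * t ^ 2 * (4 * i : ℝ)⁻¹ = t ^ 2 / 4 := by field_simp
  linarith [hlt (N.sup id)]
end

section
/- For a compact Hausdorff space K the following are equivalent: (1) K supports a strictly positive measure; (2) the family 𝒢 of all nonempty open subsets of K admits a countable decomposition 𝒢 = ⋃_{n=1}^∞ 𝒢_n such that wĩn(𝒢_n) > 0 for all n. -/
open MeasureTheory Filter Topology

/-- `l(𝒟)`: the least `k` such that every subfamily of `𝒟` with more than `k` members
has empty intersection. -/
noncomputable def interNum {α : Type*} (D : Finset (Set α)) : ℕ :=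
  sInf {k : ℕ | ∀ A : Finset (Set α), A ⊆ D → k < A.card → ⋂₀ (↑A : Set (Set α)) = ∅}

/-- The modified weak intersection number `wiñ(ℬ)` is positive: some `c > 0` is a lower
bound for `l(𝒟)/(|𝒟| - 1)` over all finite subfamilies `𝒟 ⊆ ℬ` with `|𝒟| > 1`. -/
def WtinPos {α : Type*} (B : Set (Set α)) : Prop :=
  ∃ c : ℝ, 0 < c ∧ ∀ D : Finset (Set α), ↑D ⊆ B → 2 ≤ D.card →
    c ≤ (interNum D : ℝ) / ((D.card : ℝ) - 1)

open CompactlySupported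

/-- Some point lies in at least `interNum D` members of `D`. -/
theorem exists_interNum_le_card {α : Type*} {D : Finset (Set α)} (hD : 0 < interNum D) :
    ∃ x : α, ∃ A ⊆ D, interNum D ≤ A.card ∧ ∀ V ∈ A, x ∈ V := by
  have h : interNum D - 1 ∉ {k : ℕ | ∀ A : Finset (Set α), A ⊆ D → k < A.card →
      ⋂₀ (↑A : Set (Set α)) = ∅} := Nat.notMem_of_lt_sInf (by
    change interNum D - 1 < interNum D
    omega)
  simp only [Set.mem_ofPred_eq, not_forall] at h
  obtain ⟨A, hAD, hA, hne⟩ := h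
  obtain ⟨x, hx⟩ := Set.nonempty_iff_ne_empty.2 hne
  exact ⟨x, A, hAD, by omega, fun V hV => hx V hV⟩

/-- Every subfamily of `D` with nonempty intersection has at most `interNum D` members. -/
theorem card_le_interNum {α : Type*} {D A : Finset (Set α)} (hA : A ⊆ D) {x : α}
    (hx : ∀ V ∈ A, x ∈ V) : A.card ≤ interNum D := by
  have h : interNum D ∈ {k : ℕ | ∀ A : Finset (Set α), A ⊆ D → k < A.card →
      ⋂₀ (↑A : Set (Set α)) = ∅} :=
    Nat.sInf_mem ⟨D.card, fun A hA h => absurd (Finset.card_le_card hA) (by omega)⟩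
  by_contra! hlt
  have := h A hA hlt
  exact (this ▸ (show x ∈ ⋂₀ (↑A : Set (Set α)) from fun V hV => hx V hV) : x ∈ (∅ : Set α))

theorem interNum_bound_of_injective {α ι : Type*} [Fintype ι] {B : Set (Set α)} {c : ℝ}
    (hc : 0 < c) (hB : ∀ D : Finset (Set α), ↑D ⊆ B → 2 ≤ D.card →
      c ≤ (interNum D : ℝ) / ((D.card : ℝ) - 1))
    {V : ι → Set α} (hV : Function.Injective V) (hVB : ∀ i, V i ∈ B)
    (hι : 2 ≤ Fintype.card ι) :
    ∃ x : α, c * ((Fintype.card ι : ℝ) - 1) ≤ ∑ i, (V i).indicator (fun _ => (1 : ℝ)) x := by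
  classical
  let D : Finset (Set α) := Finset.univ.image V
  have hcard : D.card = Fintype.card ι := Finset.card_image_of_injective _ hV
  have h2 : (2 : ℝ) ≤ Fintype.card ι := by exact_mod_cast hι
  have hle := hB D (by simpa [D, Set.range_subset_iff] using hVB) (by omega)
  rw [hcard, le_div_iff₀ (by linarith)] at hle
  have hpos : 0 < interNum D := by
    have : (0 : ℝ) < interNum D := lt_of_lt_of_le (mul_pos hc (by linarith)) hle
    exact_mod_cast this
  obtain ⟨x, A, hAD, hA, hx⟩ := exists_interNum_le_card hpos
  refine ⟨x, hle.trans ?_⟩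
  have hsum : ∑ i, (V i).indicator (fun _ => (1 : ℝ)) x =
      ((Finset.univ.filter fun i => x ∈ V i).card : ℝ) := by
    simp [Set.indicator_apply]
  rw [hsum]
  have hsub : A ⊆ (Finset.univ.filter fun i => x ∈ V i).image V := by
    intro W hW
    obtain ⟨i, -, rfl⟩ := Finset.mem_image.1 (hAD hW)
    exact Finset.mem_image_of_mem _ (by simpa using hx _ hW)
  exact_mod_cast hA.trans ((Finset.card_le_card hsub).trans Finset.card_image_le)

/-- The sets that contain infinitely many members of `B`. -/
def infinitelyRefined {α : Type*} (B : Set (Set α)) : Set (Set α) :=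
  {G | {V ∈ B | V ⊆ G}.Infinite}

theorem exists_injective_refinement {α ι : Type*} [Fintype ι] {B : Set (Set α)}
    {G : ι → Set α} (hG : ∀ i, G i ∈ infinitelyRefined B) :
    ∃ V : ι → Set α, Function.Injective V ∧ ∀ i, V i ∈ B ∧ V i ⊆ G i := by
  classical
  choose t ht hcard using fun i => (hG i).exists_subset_card_eq (Fintype.card ι)
  obtain ⟨V, hinj, hV⟩ := (Finset.all_card_le_biUnion_card_iff_exists_injective t).1 (by
    intro s
    obtain rfl | ⟨i, hi⟩ := s.eq_empty_or_nonempty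
    · simp
    · calc s.card ≤ Fintype.card ι := s.card_le_univ
        _ = (t i).card := (hcard i).symm
        _ ≤ (s.biUnion t).card := Finset.card_le_card (Finset.subset_biUnion_of_mem t hi))
  exact ⟨V, hinj, fun i => ht i (hV i)⟩

/-- A bound for finite subfamilies of `B` without repetition yields a Kelley type bound for
all convex combinations of indicators of sets that contain infinitely many members of `B`. -/
theorem exists_lt_weighted_sum_indicator {α ι : Type*} {B : Set (Set α)} {c : ℝ}
    (hc : 0 < c) (hB : ∀ D : Finset (Set α), ↑D ⊆ B → 2 ≤ D.card →
      c ≤ (interNum D : ℝ) / ((D.card : ℝ) - 1))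
    (t : Finset ι) (w : ι → ℝ) (hw : ∀ i ∈ t, 0 ≤ w i) (hw1 : ∑ i ∈ t, w i = 1)
    (G : ι → Set α) (hG : ∀ i ∈ t, G i ∈ infinitelyRefined B) :
    ∃ x : α, c / 2 ≤ ∑ i ∈ t, w i * (G i).indicator (fun _ => (1 : ℝ)) x := by
  classical
  let N : ℕ := 2 * (t.card + 1)
  let m : ι → ℕ := fun i => ⌊(N : ℝ) * w i⌋₊
  have hN : (N : ℝ) = 2 * (t.card + 1) := by simp [N]
  have ht : 0 < t.card := by
    rw [Finset.card_pos]
    by_contra h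
    simp [Finset.not_nonempty_iff_eq_empty.1 h] at hw1
  have ht' : (1 : ℝ) ≤ t.card := by exact_mod_cast ht
  let J := Σ i : t, Fin (m i)
  have hcard : (Fintype.card J : ℝ) = ∑ i ∈ t, (m i : ℝ) := by
    simp only [J, Fintype.card_sigma, Fintype.card_fin, Nat.cast_sum]
    exact Finset.sum_coe_sort t fun i => (m i : ℝ)
  have hlow : (t.card : ℝ) + 2 ≤ Fintype.card J := by
    rw [hcard]
    have : ∑ i ∈ t, ((N : ℝ) * w i - 1) ≤ ∑ i ∈ t, (m i : ℝ) :=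
      Finset.sum_le_sum fun i _ => (Nat.sub_one_lt_floor _).le
    rw [Finset.sum_sub_distrib, ← Finset.mul_sum, hw1] at this
    simp only [Finset.sum_const, nsmul_eq_mul, mul_one] at this
    linarith
  obtain ⟨V, hinj, hV⟩ := exists_injective_refinement (B := B) (G := fun j : J => G j.1)
    fun j => hG _ j.1.2
  obtain ⟨x, hx⟩ := interNum_bound_of_injective hc hB hinj (fun j => (hV j).1) (by
    have : (2 : ℝ) ≤ Fintype.card J := by linarith
    exact_mod_cast this)
  refine ⟨x, ?_⟩
  have hsum : ∑ j : J, (V j).indicator (fun _ => (1 : ℝ)) x ≤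
      N * ∑ i ∈ t, w i * (G i).indicator (fun _ => (1 : ℝ)) x := by
    calc ∑ j : J, (V j).indicator (fun _ => (1 : ℝ)) x
        ≤ ∑ j : J, (G j.1).indicator (fun _ => (1 : ℝ)) x :=
          Finset.sum_le_sum fun j _ =>
            Set.indicator_le_indicator_of_subset (hV j).2 (fun _ => zero_le_one) x
      _ = ∑ i ∈ t, (m i : ℝ) * (G i).indicator (fun _ => (1 : ℝ)) x := by
          rw [Fintype.sum_sigma]
          simp only [Finset.sum_const, Finset.card_univ, Fintype.card_fin, nsmul_eq_mul]
          exact Finset.sum_coe_sort t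
            fun i => (m i : ℝ) * (G i).indicator (fun _ => (1 : ℝ)) x
      _ ≤ ∑ i ∈ t, (N * w i) * (G i).indicator (fun _ => (1 : ℝ)) x := by
          refine Finset.sum_le_sum fun i hi => mul_le_mul_of_nonneg_right
            (Nat.floor_le (mul_nonneg (Nat.cast_nonneg _) (hw i hi)))
            (Set.indicator_nonneg (fun _ _ => zero_le_one) x)
      _ = _ := by simp only [Finset.mul_sum, mul_assoc]
  have h1 : c * ((t.card : ℝ) + 1) ≤ N * ∑ i ∈ t, w i * (G i).indicator (fun _ => (1 : ℝ)) x :=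
    (mul_le_mul_of_nonneg_left (by linarith) hc.le).trans (hx.trans hsum)
  rw [hN] at h1
  have h2 : (0 : ℝ) < t.card + 1 := by linarith
  by_contra! hlt
  nlinarith

/-- If every convex combination of members of `F` is somewhere at least `c`, some finite measure
gives all members of `F` a positive integral. -/
theorem exists_measure_integral_pos {K : Type*} [TopologicalSpace K] [CompactSpace K] [T2Space K]
    [MeasurableSpace K] [BorelSpace K] {F : Set C(K, ℝ)} {c : ℝ} (hc : 0 < c)
    (hF : ∀ f ∈ convexHull ℝ F, ∃ x, c ≤ f x) :
    ∃ μ : Measure K, IsFiniteMeasure μ ∧ ∀ f ∈ F, 0 < ∫ x, f x ∂μ := by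
  let s : Set C(K, ℝ) := {f | ∀ x, f x < c}
  have hs : IsOpen s := by
    have := ContinuousMap.isOpen_setOfPred_mapsTo (X := K) isCompact_univ (isOpen_Iio (a := c))
    simpa [s, Set.MapsTo] using this
  have hsc : Convex ℝ s := by
    intro f hf g hg a b ha hb hab x
    exact (convex_Iio c) (hf x) (hg x) ha hb hab
  obtain ⟨φ, u, hφs, hφF⟩ := geometric_hahn_banach_open hsc hs (convex_convexHull ℝ F) (by
    rw [Set.disjoint_left]
    intro f hf hfF
    obtain ⟨x, hx⟩ := hF f hfF
    exact absurd (hf x) (not_lt.2 hx))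
  have hu : 0 < u := by simpa using hφs 0 (fun x => by simpa using hc)
  have hφ : ∀ f : C(K, ℝ), 0 ≤ f → 0 ≤ φ f := by
    intro f hf
    by_contra! hneg
    have := hφs ((u / φ f) • f) (fun x => by
      have h1 : u / φ f ≤ 0 := div_nonpos_of_nonneg_of_nonpos hu.le hneg.le
      have h2 : 0 ≤ f x := hf x
      simp only [ContinuousMap.smul_apply, smul_eq_mul]
      nlinarith)
    rw [map_smul, smul_eq_mul, div_mul_cancel₀ _ hneg.ne] at this
    exact lt_irrefl _ this
  let Λ : C_c(K, ℝ) →ₚ[ℝ] ℝ := PositiveLinearMap.mk₀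
    { toFun := fun f => φ f.toContinuousMap
      map_add' := fun f g => φ.map_add f.toContinuousMap g.toContinuousMap
      map_smul' := fun a f => φ.map_smul a f.toContinuousMap }
    fun f hf => hφ f.toContinuousMap fun x => hf x
  refine ⟨RealRMK.rieszMeasure Λ, inferInstance, fun f hf => ?_⟩
  have h := RealRMK.integral_rieszMeasure Λ (CompactlySupportedContinuousMap.continuousMapEquiv f)
  change ∫ x, f x ∂(RealRMK.rieszMeasure Λ) = φ f at h
  rw [h]
  exact hu.trans_le (hφF f (subset_convexHull ℝ F hf))

/-- For each family with positive modified weak intersection number there is a finite measure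
that is positive on all neighbourhoods of closures of sets with infinitely many subsets in it. -/
theorem WtinPos.exists_measure {K : Type*} [TopologicalSpace K] [CompactSpace K] [T2Space K]
    [MeasurableSpace K] [BorelSpace K] {B : Set (Set K)} (hB : WtinPos B) :
    ∃ μ : Measure K, IsFiniteMeasure μ ∧ ∀ V ∈ infinitelyRefined B, ∀ G : Set K, IsOpen G →
      closure V ⊆ G → 0 < μ G := by
  obtain ⟨c, hc, hB⟩ := hB
  let F : Set C(K, ℝ) := {f | 0 ≤ f ∧ ∃ V ∈ infinitelyRefined B, ∀ x ∈ V, 1 ≤ f x}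
  obtain ⟨μ, hμ, hμF⟩ := exists_measure_integral_pos (F := F) (half_pos hc) (by
    intro f hf
    rw [convexHull_eq] at hf
    obtain ⟨ι, t, w, z, hw, hw1, hz, rfl⟩ := hf
    choose! h0 V hV h1 using hz
    obtain ⟨x, hx⟩ := exists_lt_weighted_sum_indicator hc hB t w hw hw1 V hV
    refine ⟨x, hx.trans ?_⟩
    rw [Finset.centerMass_eq_of_sum_1 _ _ hw1, ContinuousMap.sum_apply]
    refine Finset.sum_le_sum fun i hi => mul_le_mul_of_nonneg_left ?_ (hw i hi)
    exact Set.indicator_le' (h1 i hi) (fun x _ => h0 i hi x) x)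
  refine ⟨μ, hμ, fun V hV G hG hVG => ?_⟩
  obtain ⟨f, hf0, hf1, hf⟩ := exists_continuous_zero_one_of_isClosed hG.isClosed_compl
    isClosed_closure (Set.disjoint_compl_left_iff_subset.2 hVG)
  have hpos := hμF f ⟨fun x => (hf x).1, V, hV, fun x hx => (hf1 (subset_closure hx)).ge⟩
  rw [pos_iff_ne_zero]
  intro h
  rw [← setIntegral_eq_integral_of_forall_compl_eq_zero (s := G) (fun x hx => hf0 hx),
    setIntegral_measure_zero _ h] at hpos
  exact lt_irrefl _ hpos

theorem not_countable_setOf_isOpen_subset {X : Type*} [TopologicalSpace X] [T2Space X]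
    {V : Set X} (hV : IsOpen V) (hinf : V.Infinite) :
    ¬ {W : Set X | IsOpen W ∧ W.Nonempty ∧ W ⊆ V}.Countable := by
  intro hcount
  have := hinf.to_subtype
  obtain ⟨U, hUi, hUo, hUd⟩ := exists_seq_infinite_isOpen_pairwise_disjoint V
  choose p hp using fun n => (hUi n).nonempty
  let W : Set ℕ → Set X := fun S => Subtype.val '' ⋃ n ∈ S, U n
  have hmem : ∀ S n, (p n : X) ∈ W S ↔ n ∈ S := by
    intro S n
    rw [Subtype.val_injective.mem_set_image, Set.mem_iUnion₂]
    refine ⟨fun ⟨m, hm, h⟩ => ?_, fun h => ⟨n, h, hp n⟩⟩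
    rwa [hUd.eq (Set.not_disjoint_iff.2 ⟨p n, hp n, h⟩)]
  have hinj : Function.Injective W := fun S T h => by
    ext n
    rw [← hmem, ← hmem, h]
  have hcount' := (hcount.insert ∅).preimage hinj
  have huniv : W ⁻¹' insert ∅ {W : Set X | IsOpen W ∧ W.Nonempty ∧ W ⊆ V} = Set.univ := by
    refine Set.eq_univ_of_forall fun S => ?_
    refine (W S).eq_empty_or_nonempty.imp id fun h => ⟨?_, h, Subtype.coe_image_subset _ _⟩
    exact hV.isOpenMap_subtype_val _ (isOpen_biUnion fun n _ => hUo n)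
  rw [huniv, Set.countable_univ_iff] at hcount'
  obtain ⟨e, he⟩ := hcount'.exists_injective_nat
  exact Function.cantor_injective e he

theorem WtinPos.finite_setOf_singleton_mem {α : Type*} {B : Set (Set α)} (hB : WtinPos B) :
    {x | {x} ∈ B}.Finite := by
  obtain ⟨c, hc, hB⟩ := hB
  by_contra hinf
  obtain ⟨n, hn⟩ := exists_nat_gt (1 / c)
  obtain ⟨t, ht, hcard⟩ := Set.Infinite.exists_subset_card_eq hinf (n + 2)
  obtain ⟨x, hx⟩ := interNum_bound_of_injective (ι := t) hc hB (V := fun i => {(i : α)})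
    (fun i j h => Subtype.ext (Set.singleton_injective h)) (fun i => ht i.2) (by simp [hcard])
  have h1 : ∑ i : t, ({(i : α)} : Set α).indicator (fun _ => (1 : ℝ)) x ≤ 1 := by
    classical
    rw [Finset.sum_coe_sort t fun i => ({i} : Set α).indicator (fun _ => (1 : ℝ)) x]
    simp only [Set.indicator_apply, Set.mem_singleton_iff, Finset.sum_ite_eq]
    split_ifs <;> simp
  rw [div_lt_iff₀ hc] at hn
  simp only [Fintype.card_coe, hcard] at hx
  push_cast at hx
  nlinarith

theorem exists_isOpen_singleton_of_finite {X : Type*} [TopologicalSpace X] [T1Space X]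
    {V : Set X} (hV : IsOpen V) (hfin : V.Finite) {x : X} (hx : x ∈ V) :
    IsOpen ({x} : Set X) := by
  have : ({x} : Set X) = V \ (V \ {x}) := by
    rw [Set.sdiff_sdiff_cancel_left (Set.singleton_subset_iff.2 hx)]
  rw [this]
  exact hV.sdiff (hfin.subset Set.sdiff_subset).isClosed

/-- A family of measurable sets on which a finite measure has a positive lower bound has positive
modified weak intersection number. -/
theorem wtinPos_of_le_measure {α : Type*} [MeasurableSpace α] (μ : Measure α)
    [IsFiniteMeasure μ] {B : Set (Set α)} (hmeas : ∀ G ∈ B, MeasurableSet G) {c : ℝ}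
    (hc : 0 < c) (hB : ∀ G ∈ B, c ≤ μ.real G) : WtinPos B := by
  classical
  refine ⟨c / (μ.real Set.univ + 1), by positivity, fun D hD hcard => ?_⟩
  have hcard' : (2 : ℝ) ≤ D.card := by exact_mod_cast hcard
  have hint : ∀ G ∈ D, Integrable (G.indicator fun _ => (1 : ℝ)) μ := fun G hG =>
    (integrable_const 1).indicator (hmeas G (hD hG))
  have hle : (D.card : ℝ) * c ≤ interNum D * μ.real Set.univ := by
    calc (D.card : ℝ) * c = ∑ G ∈ D, c := by simp
      _ ≤ ∑ G ∈ D, μ.real G := Finset.sum_le_sum fun G hG => hB G (hD hG)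
      _ = ∑ G ∈ D, ∫ x, G.indicator (fun _ => (1 : ℝ)) x ∂μ :=
          Finset.sum_congr rfl fun G hG => by
            rw [integral_indicator (hmeas G (hD hG))]
            simp
      _ = ∫ x, ∑ G ∈ D, G.indicator (fun _ => (1 : ℝ)) x ∂μ :=
          (integral_finsetSum _ hint).symm
      _ ≤ ∫ _, (interNum D : ℝ) ∂μ := by
          refine integral_mono (integrable_finsetSum _ hint) (integrable_const _) fun x => ?_
          have := card_le_interNum (Finset.filter_subset (fun G => x ∈ G) D) (x := x)
            (fun V hV => (Finset.mem_filter.1 hV).2)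
          simpa [Set.indicator_apply] using this
      _ = interNum D * μ.real Set.univ := by simp [mul_comm]
  have hM : 0 ≤ μ.real Set.univ := measureReal_nonneg
  rw [div_le_div_iff₀ (by linarith) (by linarith)]
  nlinarith [(Nat.cast_nonneg (interNum D) : (0 : ℝ) ≤ interNum D)]

theorem exists_decomposition_of_measure {K : Type*} [TopologicalSpace K]
    [MeasurableSpace K] [BorelSpace K] (μ : Measure K) [IsFiniteMeasure μ]
    (hμ : ∀ G : Set K, IsOpen G → G.Nonempty → 0 < μ G) :
    ∃ 𝒢 : ℕ → Set (Set K), (⋃ n, 𝒢 n) = {G : Set K | IsOpen G ∧ G.Nonempty} ∧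
      ∀ n, WtinPos (𝒢 n) := by
  refine ⟨fun n => {G | (IsOpen G ∧ G.Nonempty) ∧ 1 / ((n : ℝ) + 1) ≤ μ.real G}, ?_, fun n =>
    wtinPos_of_le_measure μ (fun G hG => hG.1.1.measurableSet) (by positivity)
      fun G hG => hG.2⟩
  ext G
  simp only [Set.mem_iUnion, Set.mem_ofPred_eq, exists_and_left, and_iff_left_iff_imp]
  intro hG
  obtain ⟨n, hn⟩ := exists_nat_one_div_lt
    (ENNReal.toReal_pos (hμ G hG.1 hG.2).ne' (measure_ne_top μ G))
  exact ⟨n, hn.le⟩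

theorem exists_measure_of_decomposition {K : Type*} [TopologicalSpace K] [CompactSpace K]
    [T2Space K] [MeasurableSpace K] [BorelSpace K] {𝒢 : ℕ → Set (Set K)}
    (h𝒢 : (⋃ n, 𝒢 n) = {G : Set K | IsOpen G ∧ G.Nonempty}) (hpos : ∀ n, WtinPos (𝒢 n)) :
    ∃ μ : Measure K, IsFiniteMeasure μ ∧
      ∀ G : Set K, IsOpen G → G.Nonempty → 0 < μ G := by
  choose ν hν hνpos using fun n => (hpos n).exists_measure
  let I : Set K := {x | IsOpen ({x} : Set K)}
  have hI : I.Countable := by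
    refine (Set.countable_iUnion fun n =>
      (hpos n).finite_setOf_singleton_mem.countable).mono fun x hx => ?_
    have : ({x} : Set K) ∈ ⋃ n, 𝒢 n := h𝒢 ▸ ⟨hx, Set.singleton_nonempty x⟩
    simpa using this
  have := hI.to_subtype
  let ρ : Measure K := Measure.sum ν + Measure.sum fun x : I => Measure.dirac (x : K)
  obtain ⟨μ, hμ, hρμ, -⟩ := exists_isFiniteMeasure_absolutelyContinuous ρ
  refine ⟨μ, hμ, fun G hG hne => pos_iff_ne_zero.2 fun h0 => ?_⟩
  have hρ := hρμ h0
  rw [Measure.add_apply, add_eq_zero, Measure.sum_apply _ hG.measurableSet,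
    Measure.sum_apply _ hG.measurableSet, ENNReal.tsum_eq_zero, ENNReal.tsum_eq_zero] at hρ
  obtain ⟨x, hx⟩ := hne
  obtain ⟨V, hV, hxV, hVG⟩ : ∃ V : Set K, IsOpen V ∧ x ∈ V ∧ closure V ⊆ G := by
    obtain ⟨C, ⟨hCx, hC⟩, hCG⟩ := (closed_nhds_basis x).mem_iff.1 (hG.mem_nhds hx)
    exact ⟨interior C, isOpen_interior, mem_interior_iff_mem_nhds.2 hCx,
      (hC.closure_interior_subset).trans hCG⟩
  by_cases hfin : V.Finite
  · have := hρ.2 ⟨x, exists_isOpen_singleton_of_finite hV hfin hxV⟩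
    simp [Measure.dirac_apply' _ hG.measurableSet, hx] at this
  · suffices ∃ n, V ∈ infinitelyRefined (𝒢 n) by
      obtain ⟨n, hn⟩ := this
      exact (hνpos n V hn G hG hVG).ne' (hρ.1 n)
    by_contra! hall
    refine not_countable_setOf_isOpen_subset hV hfin
      ((Set.countable_iUnion fun n => (Set.not_infinite.1 (hall n)).countable).mono ?_)
    rintro W ⟨hWo, hWne, hWV⟩
    have : W ∈ ⋃ n, 𝒢 n := h𝒢 ▸ ⟨hWo, hWne⟩
    obtain ⟨n, hn⟩ := Set.mem_iUnion.1 this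
    exact Set.mem_iUnion.2 ⟨n, hn, hWV⟩

/-- `K` supports a strictly positive measure iff the nonempty open sets decompose into
countably many families with positive modified weak intersection number `wiñ`. -/
theorem stmt14 {K : Type*} [TopologicalSpace K] [CompactSpace K] [T2Space K]
    [MeasurableSpace K] [BorelSpace K] :
    (∃ μ : Measure K, IsFiniteMeasure μ ∧
      ∀ G : Set K, IsOpen G → G.Nonempty → 0 < μ G) ↔
    (∃ 𝒢 : ℕ → Set (Set K), (⋃ n, 𝒢 n) = {G : Set K | IsOpen G ∧ G.Nonempty} ∧
      ∀ n, WtinPos (𝒢 n)) := by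
  constructor
  · rintro ⟨μ, _, hμ⟩
    exact exists_decomposition_of_measure μ hμ
  · rintro ⟨𝒢, h𝒢, hpos⟩
    exact exists_measure_of_decomposition h𝒢 hpos
end
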